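/- Let (R,m) be a Noetherian local ring and M a finitely generated R-module with dim_R M = dim R ≥ 2. If M is an unmixed R-module, then the first local cohomology module H^1_m(M) is a finitely generated R-module. -/

import Mathlib

open IsLocalRing

section Defs

variable (R : Type) [CommRing R]

/-- The length of a module, as the Krull dimension of its lattice of submodules. -/
noncomputable def mLength (M : Type) [AddCommGroup M] [Module R M] : WithBot ℕ∞ :=
  Order.krullDim (Submodule R M)

/-- The (Krull) dimension of a module. -/
noncomputable def mDim (M : Type) [AddCommGroup M] [Module R M] : WithBot ℕ∞ :=
  ringKrullDim (R ⧸ Submodule.annihilator (⊤ : Submodule R M))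

/-- `f` is eventually given by the Hilbert-type polynomial of degree `t` with
coefficients `s 0, …, s t` (written in the binomial basis with alternating signs). -/
def IsHilbPolyAt (f : ℕ → WithBot ℕ∞) (t : ℕ) (s : ℕ → ℤ) : Prop :=
  ∃ N : ℕ, ∀ n ≥ N, ∃ l : ℕ, f n = (l : ℕ∞) ∧
    (l : ℤ) = ∑ i ∈ Finset.range (t + 1), (-1 : ℤ) ^ i * s i * ((n + t - i).choose (t - i) : ℤ)

/-- `s 0, …, s t` are the Hilbert coefficients `e_i(I, M)`, i.e.
`λ(M/I^{n+1}M) = ∑ (-1)^i e_i(I,M) C(n+t-i, t-i)` for `n ≫ 0`. -/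
def HasHilbCoeffs (I : Ideal R) (M : Type) [AddCommGroup M] [Module R M]
    (t : ℕ) (s : ℕ → ℤ) : Prop :=
  IsHilbPolyAt (fun n => mLength R (M ⧸ (I ^ (n + 1) • (⊤ : Submodule R M)))) t s

/-- The unmixed component `U_M(0)` of `M`: the largest submodule of dimension `< dim M`. -/
noncomputable def unmixedComp (M : Type) [AddCommGroup M] [Module R M] : Submodule R M :=
  sSup {N : Submodule R M | mDim R ↥N < mDim R M}

/-- `x` is a d-sequence on `M`. -/
def IsDSeq {r : ℕ} (x : Fin r → R) (M : Type) [AddCommGroup M] [Module R M] : Prop :=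
  ∀ i j : Fin r, i ≤ j →
    Submodule.comap (LinearMap.lsmul R M (x i * x j))
        (Ideal.span (x '' {k | k < i}) • (⊤ : Submodule R M))
      = Submodule.comap (LinearMap.lsmul R M (x j))
        (Ideal.span (x '' {k | k < i}) • (⊤ : Submodule R M))

/-- `x` is a standard (d⁺-) system: all power sequences in any order are d-sequences. -/
def IsStandardSeq {r : ℕ} (x : Fin r → R) (M : Type) [AddCommGroup M] [Module R M] : Prop :=
  ∀ n : Fin r → ℕ, (∀ k, 1 ≤ n k) → ∀ σ : Equiv.Perm (Fin r),
    IsDSeq R (fun k => x (σ k) ^ n (σ k)) M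

/-- The integral closure of an ideal, as a set. -/
def intClos (Q : Ideal R) : Set R :=
  {x : R | ∃ n : ℕ, 0 < n ∧ ∃ a : ℕ → R, (∀ i, 1 ≤ i → i ≤ n → a i ∈ Q ^ i) ∧
    x ^ n + ∑ i ∈ Finset.Icc 1 n, a i * x ^ (n - i) = 0}

variable [IsLocalRing R]

/-- `h ∈ I` is superficial for `M` with respect to `I`. -/
def IsSuperficial (I : Ideal R) (M : Type) [AddCommGroup M] [Module R M] (h : R) : Prop :=
  h ∈ I ∧ ∃ c N : ℕ, ∀ n ≥ N,
    Submodule.comap (LinearMap.lsmul R M h) (I ^ (n + 1) • (⊤ : Submodule R M))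
        ⊓ (I ^ c • (⊤ : Submodule R M))
      = I ^ n • (⊤ : Submodule R M)

/-- `Q` is a parameter ideal for `M` (`r` the dimension of `M`):
generated by `r` elements of the maximal ideal with `M/QM` of finite length. -/
def IsParamIdeal (Q : Ideal R) (M : Type) [AddCommGroup M] [Module R M] (r : ℕ) : Prop :=
  Q ≤ maximalIdeal R ∧ (∃ x : Fin r → R, Q = Ideal.span (Set.range x)) ∧
    IsFiniteLength R (M ⧸ Q • (⊤ : Submodule R M))

/-- Local cohomology `H^i_𝔪(M)` with support in the maximal ideal. -/
noncomputable def LC (i : ℕ) (M : Type) [AddCommGroup M] [Module R M] : ModuleCat R :=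
  (localCohomology (maximalIdeal R) i).obj (ModuleCat.of R M)

/-- `M` is Cohen–Macaulay: there is a regular sequence on `M` in the maximal ideal
whose length equals `dim M`. -/
def IsCM (M : Type) [AddCommGroup M] [Module R M] : Prop :=
  ∃ rs : List R, (∀ x ∈ rs, x ∈ maximalIdeal R) ∧ RingTheory.Sequence.IsRegular M rs ∧
    (rs.length : WithBot ℕ∞) = mDim R M

/-- `M` is unmixed: `dim R̂/p = dim M` for every associated prime `p` of the completion `M̂`. -/
def IsUnmixed (M : Type) [AddCommGroup M] [Module R M] : Prop :=
  ∀ p ∈ associatedPrimes (AdicCompletion (maximalIdeal R) R)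
      (AdicCompletion (maximalIdeal R) M),
    ringKrullDim ((AdicCompletion (maximalIdeal R) R) ⧸ p) = mDim R M

/-- `M` is generalized Cohen–Macaulay: `H^i_𝔪(M)` has finite length for `i < r = dim M`. -/
def IsGenCM (M : Type) [AddCommGroup M] [Module R M] (r : ℕ) : Prop :=
  ∀ i < r, IsFiniteLength R ↥(LC R i M)

/-- The set `Λ(M)` of first Hilbert coefficients of parameter ideals for `M`. -/
def Lambda (M : Type) [AddCommGroup M] [Module R M] (r : ℕ) : Set ℤ :=
  {a : ℤ | ∃ (Q : Ideal R) (e : ℕ → ℤ),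
    IsParamIdeal R Q M r ∧ HasHilbCoeffs R Q M r e ∧ e 1 = a}

/-- A standard parameter ideal: one generated by a standard system of parameters. -/
def IsStandardParamIdeal (Q : Ideal R) (M : Type) [AddCommGroup M] [Module R M]
    (r : ℕ) : Prop :=
  IsParamIdeal R Q M r ∧ ∃ x : Fin r → R, Q = Ideal.span (Set.range x) ∧
    IsStandardSeq R x M

/-- `M` is Buchsbaum: every parameter ideal for `M` is standard. -/
def IsBuchsbaum (M : Type) [AddCommGroup M] [Module R M] (r : ℕ) : Prop :=
  ∀ Q : Ideal R, IsParamIdeal R Q M r → IsStandardParamIdeal R Q M r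

/-- `M` is a Vasconcelos module. -/
def IsVasconcelos (M : Type) [AddCommGroup M] [Module R M] : Prop :=
  mDim R M ≤ 0 ∨ (0 < mDim R M ∧ ∃ (r : ℕ) (Q : Ideal R) (e : ℕ → ℤ),
    mDim R M = (r : ℕ∞) ∧ IsParamIdeal R Q M r ∧ HasHilbCoeffs R Q M r e ∧ e 1 = 0)

/-- A Gorenstein local ring: Noetherian, Cohen–Macaulay, with an irreducible parameter ideal. -/
def IsGorensteinLocalRing : Prop :=
  IsNoetherianRing R ∧ IsCM R R ∧ ∃ (r : ℕ) (Q : Ideal R),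
    mDim R R = (r : ℕ∞) ∧ IsParamIdeal R Q R r ∧
    ∀ I J : Ideal R, Q = I ⊓ J → Q = I ∨ Q = J

/-- `E` is an injective envelope of the residue field `R/𝔪`. -/
def IsInjEnvResidue (E : Type) [AddCommGroup E] [Module R E] : Prop :=
  Module.Injective R E ∧ ∃ ι : (R ⧸ maximalIdeal R) →ₗ[R] E, Function.Injective ι ∧
    ∀ N : Submodule R E, N ⊓ LinearMap.range ι = ⊥ → N = ⊥

end Defs

/-- A (not necessarily local) Cohen–Macaulay ring: Noetherian,
with all localizations at primes Cohen–Macaulay. -/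
def IsCMRing (S : Type) [CommRing S] : Prop :=
  IsNoetherianRing S ∧ ∀ (p : Ideal S) [p.IsPrime],
    IsCM (Localization.AtPrime p) (Localization.AtPrime p)

/-- A (not necessarily local) Gorenstein ring. -/
def IsGorensteinRing (S : Type) [CommRing S] : Prop :=
  IsNoetherianRing S ∧ ∀ (p : Ideal S) [p.IsPrime],
    IsGorensteinLocalRing (Localization.AtPrime p)

/-- `HDegRel R I E M v` : `v` is the homological degree `hdeg_I(M)` computed
with Matlis duals taken relative to `E`. -/
inductive HDegRel (R : Type) [CommRing R] [IsLocalRing R] (I : Ideal R)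
    (E : Type) [AddCommGroup E] [Module R E] : ModuleCat R → ℕ → Prop where
  | base : ∀ (M : ModuleCat R) (l : ℕ), mDim R M ≤ 0 → mLength R M = (l : ℕ∞) →
      HDegRel R I E M l
  | step : ∀ (M : ModuleCat R) (r : ℕ), mDim R M = (r : ℕ∞) → 0 < r →
      ∀ (e : ℕ → ℤ) (e0 : ℕ), HasHilbCoeffs R I M r e → e 0 = (e0 : ℤ) →
      ∀ v : ℕ → ℕ,
        (∀ j < r, HDegRel R I E (ModuleCat.of R ((LC R j M) →ₗ[R] E)) (v j)) →
      HDegRel R I E M (e0 + ∑ j ∈ Finset.range r, (r - 1).choose j * v j)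

section ConnectingMap

open CategoryTheory Limits

variable {C D : Type*} [Category* C] [Category* D] [Abelian C] [Abelian D]
  [HasProjectiveResolutions C]

lemma HomologicalComplex.homologyMap_comp_homologyι_comp_descOpcycles {ι : Type*}
    {c : ComplexShape ι} {K K' : HomologicalComplex D c} (ψ : K' ⟶ K) {i i' j : ι} {A A' : D}
    (k : K.X i ⟶ A) {hj : c.prev i = j} (hk : K.d j i ≫ k = 0)
    (k' : K'.X i ⟶ A') (hk' : K'.d j i ≫ k' = 0) (α : A' ⟶ A) (s : K'.X i' ⟶ A)
    (h : ψ.f i ≫ k = k' ≫ α + K'.d i i' ≫ s) :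
    homologyMap ψ i ≫ K.homologyι i ≫ K.descOpcycles k j hj hk =
      (K'.homologyι i ≫ K'.descOpcycles k' j hj hk') ≫ α := by
  rw [homologyι_naturality_assoc, opcyclesMap_comp_descOpcycles, Category.assoc,
    descOpcycles_comp, ← sub_eq_zero, ← Preadditive.comp_sub,
    ← K'.homologyι_descOpcycles_eq_zero_of_boundary _ j hj s rfl]
  congr 1
  rw [← cancel_epi (pOpcycles _ _)]
  simp only [Preadditive.comp_sub, p_descOpcycles, h, add_sub_cancel_left]

lemma HomologicalComplex.isIso_descOpcycles {ι : Type*} {c : ComplexShape ι}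
    (K : HomologicalComplex D c) {i : ι} {A : D} (k : K.X i ⟶ A) (j : ι) (hj : c.prev i = j)
    (hk : K.d j i ≫ k = 0) (hc : IsColimit (CokernelCofork.ofπ k hk)) :
    IsIso (K.descOpcycles k j hj hk) := by
  let e := (K.opcyclesIsCokernel j i hj).coconePointUniqueUpToIso hc
  have : K.descOpcycles k j hj hk = e.hom := by
    rw [← cancel_epi (K.pOpcycles i), K.p_descOpcycles]
    exact ((K.opcyclesIsCokernel j i hj).comp_coconePointUniqueUpToIso_hom hc
      WalkingParallelPair.one).symm
  rw [this]
  infer_instance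

namespace CategoryTheory.ProjectiveResolution

/-- The map `L₁F(X) ⟶ F(J)` induced by a map from the first term of a projective resolution of `X`
to `J` which vanishes on boundaries. -/
noncomputable def leftDerivedOneDesc {X J : C} (P : ProjectiveResolution X) (F : C ⥤ D)
    [F.Additive] (g : P.complex.X 1 ⟶ J) (hg : P.complex.d 2 1 ≫ g = 0) :
    (F.leftDerived 1).obj X ⟶ F.obj J :=
  (P.isoLeftDerivedObj F 1).hom ≫
    ((F.mapHomologicalComplex _).obj P.complex).homologyι 1 ≫
      ((F.mapHomologicalComplex _).obj P.complex).descOpcycles (F.map g) 2 (by simp)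
        (by
          change F.map _ ≫ F.map g = 0
          rw [← F.map_comp, hg, F.map_zero])

/-- The maps `leftDerivedOneDesc` attached to presentations `J ⟶ Q ⟶ X` are natural. -/
lemma leftDerivedOneDesc_naturality (F : C ⥤ D) [F.Additive] {S S' : ShortComplex C} [Mono S.f]
    (hS : S.Exact) (τ : S' ⟶ S)
    (P : ProjectiveResolution S.X₃) (P' : ProjectiveResolution S'.X₃)
    {h : P.complex.X 0 ⟶ S.X₂} (hh : h ≫ S.g = P.π.f 0)
    {h' : P'.complex.X 0 ⟶ S'.X₂} (hh' : h' ≫ S'.g = P'.π.f 0)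
    {g : P.complex.X 1 ⟶ S.X₁} (hg : P.complex.d 2 1 ≫ g = 0)
    (hgh : g ≫ S.f = P.complex.d 1 0 ≫ h)
    {g' : P'.complex.X 1 ⟶ S'.X₁} (hg' : P'.complex.d 2 1 ≫ g' = 0)
    (hgh' : g' ≫ S'.f = P'.complex.d 1 0 ≫ h') :
    (F.leftDerived 1).map τ.τ₃ ≫ P.leftDerivedOneDesc F g hg =
      P'.leftDerivedOneDesc F g' hg' ≫ F.map τ.τ₁ := by
  let φ := lift τ.τ₃ P' P
  have hφ0 : φ.f 0 ≫ P.π.f 0 = P'.π.f 0 ≫ τ.τ₃ := lift_commutes_zero _ _ _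
  have key : (φ.f 0 ≫ h - h' ≫ τ.τ₂) ≫ S.g = 0 := by
    rw [Preadditive.sub_comp, Category.assoc, Category.assoc, hh, τ.comm₂₃, reassoc_of% hh']
    exact sub_eq_zero.mpr hφ0
  have ht := hS.lift_f _ key
  set t := hS.lift _ key
  have hd : φ.f 1 ≫ g = g' ≫ τ.τ₁ + P'.complex.d 1 0 ≫ t := by
    rw [← cancel_mono S.f, Preadditive.add_comp, Category.assoc, Category.assoc, Category.assoc,
      ht, hgh, τ.comm₁₂, reassoc_of% hgh', Preadditive.comp_sub, φ.comm_assoc]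
    abel
  unfold leftDerivedOneDesc
  rw [isoLeftDerivedObj_hom_naturality_assoc τ.τ₃ P' P φ hφ0, Category.assoc]
  refine congrArg ((P'.isoLeftDerivedObj F 1).hom ≫ ·)
    (HomologicalComplex.homologyMap_comp_homologyι_comp_descOpcycles
      ((F.mapHomologicalComplex _).map φ) (i' := 0) _ _ _ _ (F.map τ.τ₁) (F.map t) ?_)
  change F.map _ ≫ F.map _ = F.map _ ≫ F.map _ + F.map _ ≫ F.map _
  simp only [← F.map_comp, hd]
  exact F.map_add

/-- `leftDerivedOneDesc` is a monomorphism if the given map is a cokernel of the differential. -/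
lemma mono_leftDerivedOneDesc {X J : C} (P : ProjectiveResolution X) (F : C ⥤ D)
    [F.Additive] [PreservesFiniteColimits F] (g : P.complex.X 1 ⟶ J)
    (hg : P.complex.d 2 1 ≫ g = 0) (hex : (ShortComplex.mk _ _ hg).Exact) [Epi g] :
    Mono (P.leftDerivedOneDesc F g hg) := by
  have hc : IsColimit (CokernelCofork.ofπ (F.map g)
      (by rw [← F.map_comp, hg, F.map_zero] : F.map (P.complex.d 2 1) ≫ F.map g = 0)) :=
    CokernelCofork.mapIsColimit _ hex.gIsCokernel F
  have := HomologicalComplex.isIso_descOpcycles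
    ((F.mapHomologicalComplex (ComplexShape.down ℕ)).obj P.complex) (F.map g) 2 (by simp) _ hc
  have := mono_comp (((F.mapHomologicalComplex (ComplexShape.down ℕ)).obj P.complex).homologyι 1)
    (((F.mapHomologicalComplex (ComplexShape.down ℕ)).obj P.complex).descOpcycles (F.map g) 2 _ _)
  exact @mono_comp _ _ _ _ _ _ inferInstance _ this

end CategoryTheory.ProjectiveResolution

namespace CategoryTheory.ShortComplex

variable {S S' : ShortComplex C}

omit [HasProjectiveResolutions C] in
lemma ShortExact.exists_resolution_maps (hS : S.ShortExact) (P : ProjectiveResolution S.X₃) :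
    ∃ (h : P.complex.X 0 ⟶ S.X₂) (g : P.complex.X 1 ⟶ S.X₁), h ≫ S.g = P.π.f 0 ∧
      P.complex.d 2 1 ≫ g = 0 ∧ g ≫ S.f = P.complex.d 1 0 ≫ h := by
  have := hS.epi_g
  have := hS.mono_f
  let h : P.complex.X 0 ⟶ S.X₂ := Projective.factorThru (X := S.X₃) (P.π.f 0) S.g
  have hh : h ≫ S.g = P.π.f 0 := Projective.factorThru_comp (X := S.X₃) _ _
  have hd : (P.complex.d 1 0 ≫ h) ≫ S.g = 0 := by
    rw [Category.assoc, hh]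
    exact P.complex_d_comp_π_f_zero
  refine ⟨h, hS.exact.lift _ hd, hh, ?_, hS.exact.lift_f _ _⟩
  rw [← cancel_mono S.f, Category.assoc, hS.exact.lift_f, zero_comp,
    HomologicalComplex.d_comp_d_assoc, zero_comp]

/-- The connecting map `L₁F(X₃) ⟶ F(X₁)` of a short exact sequence `0 ⟶ X₁ ⟶ X₂ ⟶ X₃ ⟶ 0`. -/
noncomputable def ShortExact.leftDerivedOneδ (F : C ⥤ D) [F.Additive] (hS : S.ShortExact) :
    (F.leftDerived 1).obj S.X₃ ⟶ F.obj S.X₁ :=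
  have h := hS.exists_resolution_maps (projectiveResolution S.X₃)
  (projectiveResolution S.X₃).leftDerivedOneDesc F h.choose_spec.choose
    h.choose_spec.choose_spec.2.1

lemma ShortExact.leftDerivedOneδ_naturality (F : C ⥤ D) [F.Additive] (hS : S.ShortExact)
    (hS' : S'.ShortExact) (τ : S' ⟶ S) :
    (F.leftDerived 1).map τ.τ₃ ≫ hS.leftDerivedOneδ F = hS'.leftDerivedOneδ F ≫ F.map τ.τ₁ := by
  have := hS.mono_f
  have h := (hS.exists_resolution_maps (projectiveResolution S.X₃)).choose_spec.choose_spec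
  have h' := (hS'.exists_resolution_maps (projectiveResolution S'.X₃)).choose_spec.choose_spec
  exact ProjectiveResolution.leftDerivedOneDesc_naturality F hS.exact τ _ _ h.1 h'.1 h.2.1 h.2.2
    h'.2.1 h'.2.2

lemma ShortExact.mono_leftDerivedOneδ (F : C ⥤ D) [F.Additive] [PreservesFiniteColimits F]
    (hS : S.ShortExact) [Projective S.X₂] : Mono (hS.leftDerivedOneδ F) := by
  have := hS.mono_f
  let P := projectiveResolution S.X₃
  let p : P.complex.X 0 ⟶ S.X₃ := P.π.f 0
  have hp : Epi p := inferInstanceAs (Epi (P.π.f 0))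
  let T : ShortComplex C := ShortComplex.mk (kernel.ι p) p (kernel.condition _)
  have hT : T.Exact := ShortComplex.exact_kernel _
  let g : P.complex.X 1 ⟶ T.X₁ := kernel.lift p (P.complex.d 1 0) P.complex_d_comp_π_f_zero
  have hgf : g ≫ T.f = P.complex.d 1 0 := kernel.lift_ι _ _ _
  have hg : P.complex.d 2 1 ≫ g = 0 := by
    rw [← cancel_mono T.f, Category.assoc, hgf, zero_comp, HomologicalComplex.d_comp_d]
  have hex : (ShortComplex.mk _ _ hg).Exact := by
    let φ : ShortComplex.mk _ _ hg ⟶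
        ShortComplex.mk _ _ (P.complex.d_comp_d 2 1 0) := ⟨𝟙 _, 𝟙 _, T.f, by simp, by simp [hgf]⟩
    have : Epi φ.τ₁ := inferInstanceAs (Epi (𝟙 _))
    have : IsIso φ.τ₂ := inferInstanceAs (IsIso (𝟙 _))
    have : Mono φ.τ₃ := inferInstanceAs (Mono T.f)
    exact (ShortComplex.exact_iff_of_epi_of_isIso_of_mono φ).2 (P.exact_succ 0)
  have hepi : Epi g := (ShortComplex.exact_iff_epi_kernel_lift _).1 P.exact₀
  let s : S.X₂ ⟶ T.X₂ := Projective.factorThru S.g p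
  have hs : s ≫ p = S.g := Projective.factorThru_comp _ _
  have hs' : (S.f ≫ s) ≫ T.g = 0 := by rw [Category.assoc, hs, S.zero]
  let τ : S ⟶ T := ⟨hT.lift (S.f ≫ s) hs', s, 𝟙 _, hT.lift_f _ _, by
    rw [hs, Category.comp_id]⟩
  have := P.mono_leftDerivedOneDesc F g hg hex
  have h := (hS.exists_resolution_maps P).choose_spec.choose_spec
  have key := ProjectiveResolution.leftDerivedOneDesc_naturality F hT τ P P (h := 𝟙 _)
    (Category.id_comp _) h.1 hg (by rw [hgf, Category.comp_id]) h.2.1 h.2.2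
  rw [(F.leftDerived 1).map_id, Category.id_comp] at key
  exact mono_of_mono_fac key.symm

end CategoryTheory.ShortComplex

end ConnectingMap

section LocalCohomologyOne

open CategoryTheory Limits Opposite

universe u

variable {R : Type u} [CommRing R]

instance (M : ModuleCat.{u} R) :
    PreservesFiniteLimits ((linearYoneda R (ModuleCat.{u} R)).obj M) :=
  have : PreservesLimitsOfSize.{0, 0} ((linearYoneda R (ModuleCat.{u} R)).obj M ⋙ forget _) :=
    inferInstanceAs (PreservesLimitsOfSize.{0, 0} (yoneda.obj M))
  have : PreservesLimitsOfSize.{0, 0} ((linearYoneda R (ModuleCat.{u} R)).obj M) :=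
    preservesLimits_of_reflects_of_preserves _ (forget _)
  inferInstance

/-- The contravariant functor `Hom(-, M)`, with values in the opposite category. -/
noncomputable abbrev homInto (M : ModuleCat.{u} R) : ModuleCat.{u} R ⥤ (ModuleCat.{u} R)ᵒᵖ :=
  ((linearYoneda R (ModuleCat.{u} R)).obj M).rightOp

instance (M : ModuleCat.{u} R) : PreservesFiniteColimits (homInto M) :=
  preservesFiniteColimits_rightOp _

/-- The short complex `J ⟶ R ⟶ R/J`. -/
noncomputable def Ideal.quotientShortComplex (J : Ideal R) : ShortComplex (ModuleCat.{u} R) :=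
  ShortComplex.mk (ModuleCat.ofHom J.subtype) (ModuleCat.ofHom J.mkQ) (by
    ext x
    exact Ideal.Quotient.eq_zero_iff_mem.2 x.2)

lemma Ideal.quotientShortComplex_shortExact (J : Ideal R) : J.quotientShortComplex.ShortExact where
  exact := by
    rw [ShortComplex.moduleCat_exact_iff_range_eq_ker]
    exact J.range_subtype.trans J.ker_mkQ.symm
  mono_f := (ModuleCat.mono_iff_injective _).2 J.injective_subtype
  epi_g := (ModuleCat.epi_iff_surjective _).2 J.mkQ_surjective

/-- The connecting map `Hom(J, M) ⟶ Ext¹(R/J, M)`. -/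
noncomputable def extOneOfHom (M : ModuleCat.{u} R) (J : Ideal R) :
    (J →ₗ[R] M) →ₗ[R] ((Ext R (ModuleCat.{u} R) 1).obj (op (ModuleCat.of R (R ⧸ J)))).obj M :=
  (J.quotientShortComplex_shortExact.leftDerivedOneδ (homInto M)).unop.hom ∘ₗ
    (ModuleCat.homLinearEquiv (M := ModuleCat.of R J) (N := M) (S := R)).symm.toLinearMap

lemma extOneOfHom_surjective (M : ModuleCat.{u} R) (J : Ideal R) :
    Function.Surjective (extOneOfHom M J) := by
  have : Projective J.quotientShortComplex.X₂ :=
    inferInstanceAs (Projective (ModuleCat.of R R))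
  have := J.quotientShortComplex_shortExact.mono_leftDerivedOneδ (homInto M)
  intro y
  obtain ⟨φ, hφ⟩ := (ModuleCat.epi_iff_surjective
    (J.quotientShortComplex_shortExact.leftDerivedOneδ (homInto M)).unop).1 inferInstance y
  exact ⟨(show ModuleCat.of R J ⟶ M from φ).hom, hφ⟩

lemma map_extOneOfHom (M : ModuleCat.{u} R) {J' J : Ideal R} (h : J' ≤ J) (φ : J →ₗ[R] M) :
    ((Ext R (ModuleCat.{u} R) 1).map (ModuleCat.ofHom
      (Submodule.mapQ J' J LinearMap.id h) :
        ModuleCat.of R (R ⧸ J') ⟶ ModuleCat.of R (R ⧸ J)).op).app M (extOneOfHom M J φ) =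
      extOneOfHom M J' (φ ∘ₗ Submodule.inclusion h) := by
  let τ : J'.quotientShortComplex ⟶ J.quotientShortComplex :=
    ⟨ModuleCat.ofHom (Submodule.inclusion h), 𝟙 _,
      ModuleCat.ofHom (Submodule.mapQ J' J LinearMap.id h), rfl, rfl⟩
  have key := J.quotientShortComplex_shortExact.leftDerivedOneδ_naturality (homInto M)
    J'.quotientShortComplex_shortExact τ
  exact congrArg (fun f => f.unop (ModuleCat.ofHom φ : ModuleCat.of R J ⟶ M)) key

/-- The natural map `Hom(Iⁿ, M) ⟶ H¹_I(M)`. -/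
noncomputable def localCohomologyOneOfHom (I : Ideal R) (M : ModuleCat.{u} R) (n : ℕ) :
    (↥(I ^ n) →ₗ[R] M) →ₗ[R] (localCohomology I 1).obj M :=
  ((colimit.ι (localCohomology.diagram (localCohomology.idealPowersDiagram I) 1)
    (op (op n))).app M).hom ∘ₗ extOneOfHom M (I ^ n)

lemma localCohomologyOneOfHom_inclusion (I : Ideal R) (M : ModuleCat.{u} R) {n n' : ℕ}
    (h : n ≤ n') (φ : ↥(I ^ n) →ₗ[R] M) :
    localCohomologyOneOfHom I M n'
      (φ ∘ₗ Submodule.inclusion (Ideal.pow_le_pow_right h)) = localCohomologyOneOfHom I M n φ := by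
  have key := congrArg (fun f => f.app M (extOneOfHom M (I ^ n) φ))
    (colimit.w (localCohomology.diagram (localCohomology.idealPowersDiagram I) 1)
      (homOfLE h).op.op)
  exact (congrArg ((colimit.ι (localCohomology.diagram (localCohomology.idealPowersDiagram I) 1)
    (op (op n'))).app M) (map_extOneOfHom M (Ideal.pow_le_pow_right h) φ).symm).trans key

lemma exists_localCohomologyOneOfHom_eq (I : Ideal R) (M : ModuleCat.{u} R)
    (x : (localCohomology I 1).obj M) : ∃ n φ, localCohomologyOneOfHom I M n φ = x := by
  have := preservesSmallestFilteredColimits_of_preservesFilteredColimits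
    (forget (ModuleCat.{u} R))
  have : PreservesColimitsOfShape ℕᵒᵖᵒᵖ (forget (ModuleCat.{u} R)) :=
    PreservesFilteredColimitsOfSize.preserves_filtered_colimits _
  obtain ⟨j, y, hy⟩ := Concrete.isColimit_exists_rep _ (isColimitOfPreserves
    ((evaluation _ _).obj M) (colimit.isColimit
      (localCohomology.diagram (localCohomology.idealPowersDiagram I) 1))) x
  obtain ⟨φ, rfl⟩ := extOneOfHom_surjective M (I ^ j.unop.unop) y
  exact ⟨_, φ, hy⟩

/-- `H¹_I(M)` is finite if every homomorphism `Iⁿ ⟶ M` agrees on a smaller power of `I` with one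
defined on a fixed power of `I`. -/
lemma finite_localCohomology_one [IsNoetherianRing R] (I : Ideal R) (M : ModuleCat.{u} R)
    [Module.Finite R M] (N : ℕ)
    (H : ∀ (n : ℕ) (φ : ↥(I ^ n) →ₗ[R] M), ∃ (n' : ℕ) (h : n ≤ n') (h' : N ≤ n')
      (ψ : ↥(I ^ N) →ₗ[R] M), φ ∘ₗ Submodule.inclusion (Ideal.pow_le_pow_right h) =
        ψ ∘ₗ Submodule.inclusion (Ideal.pow_le_pow_right h')) :
    Module.Finite R ((localCohomology I 1).obj M) := by
  refine Module.Finite.of_surjective (localCohomologyOneOfHom I M N) fun x => ?_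
  obtain ⟨n, φ, rfl⟩ := exists_localCohomologyOneOfHom_eq I M x
  obtain ⟨n', h, h', ψ, hψ⟩ := H n φ
  refine ⟨ψ, ?_⟩
  rw [← localCohomologyOneOfHom_inclusion I M h φ, hψ, localCohomologyOneOfHom_inclusion I M h' ψ]

end LocalCohomologyOne

section PowSaturation

variable {R : Type*} [CommRing R] (I : Ideal R) (x : R) (M : Type*) [AddCommGroup M] [Module R M]

/-- The elements of `M` which are multiplied into `xⁿM` by some power of `I`. -/
def powSaturation (n : ℕ) : Submodule R M where
  carrier := {w | ∃ k, ∀ a ∈ I ^ k, ∃ v : M, x ^ n • v = a • w}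
  zero_mem' := ⟨0, fun a _ => ⟨0, by simp⟩⟩
  add_mem' := by
    rintro w w' ⟨k, hk⟩ ⟨k', hk'⟩
    refine ⟨max k k', fun a ha => ?_⟩
    obtain ⟨v, hv⟩ := hk a (Ideal.pow_le_pow_right (le_max_left _ _) ha)
    obtain ⟨v', hv'⟩ := hk' a (Ideal.pow_le_pow_right (le_max_right _ _) ha)
    exact ⟨v + v', by rw [smul_add, smul_add, hv, hv']⟩
  smul_mem' := by
    rintro r w ⟨k, hk⟩
    refine ⟨k, fun a ha => ?_⟩
    obtain ⟨v, hv⟩ := hk a ha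
    exact ⟨r • v, by rw [smul_comm, hv, smul_comm]⟩

variable {I x M}

lemma powSaturation_antitone : Antitone (powSaturation I x M) := by
  rintro n n' hn w ⟨k, hk⟩
  refine ⟨k, fun a ha => ?_⟩
  obtain ⟨v, hv⟩ := hk a ha
  exact ⟨x ^ (n' - n) • v, by rw [smul_smul, ← pow_add, Nat.add_sub_cancel' hn, hv]⟩

lemma pow_smul_mem_powSaturation (n : ℕ) (v : M) : x ^ n • v ∈ powSaturation I x M n :=
  ⟨0, fun a _ => ⟨a • v, smul_comm _ _ _⟩⟩

lemma smul_mem_powSaturation_succ {n : ℕ} {v : M} (hv : v ∈ powSaturation I x M n) :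
    x • v ∈ powSaturation I x M (n + 1) := by
  obtain ⟨k, hk⟩ := hv
  refine ⟨k, fun a ha => ?_⟩
  obtain ⟨u, hu⟩ := hk a ha
  exact ⟨u, by rw [pow_succ', mul_smul, hu, smul_comm]⟩

lemma mem_powSaturation_of_smul_mem (hx : IsSMulRegular M x) {n : ℕ} {v : M}
    (hv : x • v ∈ powSaturation I x M (n + 1)) : v ∈ powSaturation I x M n := by
  obtain ⟨k, hk⟩ := hv
  refine ⟨k, fun a ha => ?_⟩
  obtain ⟨u, hu⟩ := hk a ha
  refine ⟨u, hx ?_⟩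
  change x • x ^ n • u = x • a • v
  rw [smul_comm x a v, ← hu, pow_succ', mul_smul]

/-- A single power of `I` multiplies the whole of `powSaturation I x M n` into `xⁿM`. -/
lemma exists_pow_smul_powSaturation [IsNoetherian R M] (n : ℕ) :
    ∃ k, ∀ a ∈ I ^ k, ∀ w ∈ powSaturation I x M n, ∃ v : M, x ^ n • v = a • w := by
  let C : ℕ →o Submodule R M :=
    { toFun := fun k => ⨅ a ∈ I ^ k, (LinearMap.range (LinearMap.lsmul R M (x ^ n))).comap
        (LinearMap.lsmul R M a)
      monotone' := fun k k' hk => le_iInf₂ fun a ha =>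
        iInf₂_le a (Ideal.pow_le_pow_right hk ha) }
  have hC {k : ℕ} {w : M} : w ∈ C k ↔ ∀ a ∈ I ^ k, ∃ v : M, x ^ n • v = a • w := by
    change w ∈ (⨅ a ∈ I ^ k, (LinearMap.range (LinearMap.lsmul R M (x ^ n))).comap
        (LinearMap.lsmul R M a)) ↔ _
    simp
  obtain ⟨k, hk⟩ := monotone_stabilizes_iff_noetherian.2 ‹_› C
  refine ⟨k, fun a ha w ⟨l, hl⟩ => ?_⟩
  have hw : w ∈ C (max k l) := C.monotone (le_max_right k l) (hC.2 hl)
  rw [← hk _ (le_max_left _ _)] at hw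
  exact hC.1 hw a ha

end PowSaturation

section Artinian

variable {R : Type*} [CommRing R] [IsLocalRing R] [IsNoetherianRing R]

lemma isArtinianRing_quotient_maximalIdeal_pow (k : ℕ) :
    IsArtinianRing (R ⧸ maximalIdeal R ^ (k + 1)) := by
  refine quotient_artinian_of_mem_minimalPrimes_of_isLocalRing _ ?_
  rw [← Ideal.radical_minimalPrimes, Ideal.radical_pow _ (Nat.succ_ne_zero k),
    Ideal.IsPrime.radical inferInstance, Ideal.minimalPrimes_eq_subsingleton_self]
  rfl

lemma isArtinian_of_maximalIdeal_pow_smul (Q : Type*) [AddCommGroup Q] [Module R Q]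
    [Module.Finite R Q] (k : ℕ) (hk : ∀ a ∈ maximalIdeal R ^ k, ∀ q : Q, a • q = 0) :
    IsArtinian R Q := by
  have hT : Module.IsTorsionBySet R Q (maximalIdeal R ^ (k + 1) : Ideal R) := fun q a =>
    hk a (Ideal.pow_le_pow_right k.le_succ a.2) q
  let := hT.module
  have := isArtinianRing_quotient_maximalIdeal_pow (R := R) k
  have : IsScalarTower R (R ⧸ maximalIdeal R ^ (k + 1)) Q := hT.isScalarTower
  have : Module.Finite (R ⧸ maximalIdeal R ^ (k + 1)) Q :=
    Module.Finite.of_restrictScalars_finite R _ _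
  have : IsArtinian (R ⧸ maximalIdeal R ^ (k + 1)) Q := inferInstance
  let e : Q →ₛₗ[Ideal.Quotient.mk (maximalIdeal R ^ (k + 1))] Q :=
    { toFun := id, map_add' := fun _ _ => rfl, map_smul' := fun _ _ => rfl }
  exact (e.isArtinian_iff_of_bijective Function.bijective_id).2 this

/-- Modulo `xM`, the submodules `powSaturation` stabilize. -/
lemma exists_powSaturation_le_sup (x : R) (M : Type*) [AddCommGroup M] [Module R M]
    [Module.Finite R M] :
    ∃ c, ∀ n, c ≤ n → ∀ w ∈ powSaturation (maximalIdeal R) x M n,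
      ∃ w' ∈ powSaturation (maximalIdeal R) x M (n + 1), ∃ v : M, w = w' + x • v := by
  let W := powSaturation (maximalIdeal R) x M
  let A : Submodule R (W 1) := (LinearMap.range (LinearMap.lsmul R M x)).comap (W 1).subtype
  obtain ⟨k, hk⟩ := exists_pow_smul_powSaturation (I := maximalIdeal R) (x := x) (M := M) 1
  have : IsArtinian R (W 1 ⧸ A) := by
    refine isArtinian_of_maximalIdeal_pow_smul _ k fun a ha q => ?_
    obtain ⟨w, rfl⟩ := A.mkQ_surjective q
    obtain ⟨v, hv⟩ := hk a ha w w.2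
    rw [← map_smul]
    exact (Submodule.Quotient.mk_eq_zero _).2 ⟨v, by simpa using hv⟩
  let V : ℕ →o (Submodule R (W 1 ⧸ A))ᵒᵈ :=
    { toFun := fun n => OrderDual.toDual (((W n).comap (W 1).subtype).map A.mkQ)
      monotone' := fun n n' h =>
        Submodule.map_mono (Submodule.comap_mono (powSaturation_antitone h)) }
  obtain ⟨c, hc⟩ := IsArtinian.monotone_stabilizes V
  refine ⟨c + 1, fun n hn w hw => ?_⟩
  have hw1 : w ∈ W 1 := powSaturation_antitone (by omega : 1 ≤ n) hw
  have hV : ((W n).comap (W 1).subtype).map A.mkQ = ((W (n + 1)).comap (W 1).subtype).map A.mkQ :=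
    (hc n (by omega)).symm.trans (hc (n + 1) (by omega))
  have hmem : A.mkQ ⟨w, hw1⟩ ∈ ((W n).comap (W 1).subtype).map A.mkQ :=
    Submodule.mem_map_of_mem hw
  rw [hV] at hmem
  obtain ⟨w', hw', h⟩ := hmem
  obtain ⟨v, hv⟩ := (Submodule.Quotient.eq A).1 h.symm
  refine ⟨w', hw', v, ?_⟩
  have hv' : x • v = w - w' := hv
  rw [hv', add_sub_cancel]

/-- An iterated form of the stabilization of `powSaturation` modulo `xM`. -/
lemma exists_powSaturation_le_sup_pow {x : R} {M : Type*} [AddCommGroup M] [Module R M]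
    [Module.Finite R M] (hx : IsSMulRegular M x) :
    ∃ c, ∀ i, ∀ w ∈ powSaturation (maximalIdeal R) x M (c + i),
      ∃ w' ∈ powSaturation (maximalIdeal R) x M (c + i + 1),
        ∃ v : M, w = w' + x ^ (i + 1) • v := by
  obtain ⟨c, hc⟩ := exists_powSaturation_le_sup x M
  refine ⟨c, fun i => ?_⟩
  induction i with
  | zero => simpa using hc c le_rfl
  | succ i ih =>
    intro w hw
    obtain ⟨w', hw', v, rfl⟩ := hc _ (by omega) w hw
    have hv : x • v ∈ powSaturation (maximalIdeal R) x M (c + i + 1) := by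
      have := sub_mem hw (powSaturation_antitone (Nat.le_succ _) hw')
      rwa [add_sub_cancel_left] at this
    obtain ⟨v', hv', u, rfl⟩ := ih v (mem_powSaturation_of_smul_mem hx hv)
    refine ⟨w' + x • v', add_mem hw' (smul_mem_powSaturation_succ hv'), u, ?_⟩
    rw [smul_add, smul_smul, ← pow_succ']
    exact (add_assoc _ _ _).symm

end Artinian

section Extension

variable {R : Type*} [CommRing R] {M : Type*} [AddCommGroup M] [Module R M]

/-- If `powSaturation I x M c` is eventually contained in `xM`, then homomorphisms
`Iⁿ ⟶ M` extend to a fixed power of `I`, after restriction. -/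
lemma exists_extension_of_powSaturation_le [IsNoetherian R M] {I : Ideal R} {x : R} (hxI : x ∈ I)
    (hx : IsSMulRegular M x) {c : ℕ}
    (hc : ∀ w ∈ powSaturation I x M c, ∃ v : M, w = x • v) :
    ∃ N, ∀ (n : ℕ) (φ : ↥(I ^ n) →ₗ[R] M), ∃ (n' : ℕ) (h : n ≤ n') (h' : N ≤ n')
      (ψ : ↥(I ^ N) →ₗ[R] M), φ ∘ₗ Submodule.inclusion (Ideal.pow_le_pow_right h) =
        ψ ∘ₗ Submodule.inclusion (Ideal.pow_le_pow_right h') := by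
  have hdiv : ∀ i, ∀ w ∈ powSaturation I x M (c + i), ∃ w' ∈ powSaturation I x M c,
      w = x ^ i • w' := by
    intro i
    induction i with
    | zero => exact fun w hw => ⟨w, hw, by simp⟩
    | succ i ih =>
      intro w hw
      obtain ⟨v, rfl⟩ := hc w (powSaturation_antitone (by omega) hw)
      obtain ⟨w', hw', rfl⟩ := ih v (mem_powSaturation_of_smul_mem hx hw)
      exact ⟨w', hw', by rw [smul_smul, pow_succ']⟩
  obtain ⟨N, hN⟩ := exists_pow_smul_powSaturation (I := I) (x := x) (M := M) c
  refine ⟨N, fun n φ => ?_⟩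
  let n₁ := c + n
  let y : ↥(I ^ n) := ⟨x ^ n₁, Ideal.pow_le_pow_right (by omega) (Ideal.pow_mem_pow hxI n₁)⟩
  have hφ (a : ↥(I ^ n)) : x ^ n₁ • φ a = a.1 • φ y := by
    rw [← map_smul, ← map_smul]
    congr 1
    ext
    exact mul_comm _ _
  obtain ⟨w, hw, hyw⟩ := hdiv n (φ y) ⟨n, fun a ha => ⟨φ ⟨a, ha⟩, hφ ⟨a, ha⟩⟩⟩
  let e := LinearEquiv.ofInjective (LinearMap.lsmul R M (x ^ c)) (hx.pow c)
  let ψ : ↥(I ^ N) →ₗ[R] M := e.symm.toLinearMap ∘ₗ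
    ((LinearMap.toSpanSingleton R M w) ∘ₗ (I ^ N).subtype).codRestrict _
      fun a => hN a a.2 w hw
  have hψ (a : ↥(I ^ N)) : x ^ c • ψ a = a.1 • w :=
    congrArg Subtype.val (e.apply_symm_apply _)
  refine ⟨max n N, le_max_left _ _, le_max_right _ _, ψ, LinearMap.ext fun a => hx.pow n₁ ?_⟩
  change x ^ n₁ • φ _ = x ^ n₁ • ψ _
  rw [hφ, hyw, show n₁ = n + c from add_comm _ _, pow_add, mul_smul, hψ, smul_comm]
  rfl

end Extension

section Separation

variable {R : Type*} [CommRing R] [IsNoetherianRing R]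

lemma exists_isPrime_mem_ne_maximalIdeal [IsLocalRing R] {x : R} (hx : x ∈ maximalIdeal R)
    (q : Ideal R) [q.IsPrime] (hq : 2 ≤ ringKrullDim (R ⧸ q)) :
    ∃ p : Ideal R, p.IsPrime ∧ q ≤ p ∧ x ∈ p ∧ p ≠ maximalIdeal R := by
  have : IsLocalRing (R ⧸ q) := .of_surjective' _ (Ideal.Quotient.mk_surjective (I := q))
  have hmk {s : R} (hs : Ideal.Quotient.mk q s ∈ maximalIdeal (R ⧸ q)) : s ∈ maximalIdeal R :=
    fun h => hs (h.map _)
  have hxT : Ideal.Quotient.mk q x ∈ maximalIdeal (R ⧸ q) := fun h => hx <| by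
    have := IsLocalHom.of_surjective (Ideal.Quotient.mk q) Ideal.Quotient.mk_surjective
    exact isUnit_of_map_unit (Ideal.Quotient.mk q) x h
  obtain ⟨P, hP, hPm⟩ := Ideal.exists_minimalPrimes_le
    (I := Ideal.span {Ideal.Quotient.mk q x}) (J := maximalIdeal (R ⧸ q))
    ((Ideal.span_singleton_le_iff_mem _).2 hxT)
  have hPprime : P.IsPrime := hP.1.1
  refine ⟨P.comap (Ideal.Quotient.mk q), inferInstance, ?_,
    hP.1.2 (Ideal.mem_span_singleton_self _), fun h => ?_⟩
  · intro a ha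
    rw [Ideal.mem_comap, Ideal.Quotient.eq_zero_iff_mem.2 ha]
    exact zero_mem _
  · have hPeq : P = maximalIdeal (R ⧸ q) := by
      refine le_antisymm hPm fun y hy => ?_
      obtain ⟨s, rfl⟩ := Ideal.Quotient.mk_surjective y
      exact (h ▸ hmk hy : s ∈ P.comap (Ideal.Quotient.mk q))
    have h1 := Ideal.height_le_one_of_isPrincipal_of_mem_minimalPrimes _ P hP
    rw [hPeq] at h1
    rw [← maximalIdeal_height_eq_ringKrullDim] at hq
    have h2 : (2 : ℕ∞) ≤ 1 := le_trans (WithBot.coe_le_coe.1 hq) h1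
    exact absurd h2 (by decide)

lemma exists_notMem_smul_eq_zero {N : Type*} [AddCommGroup N] [Module R N] [Module.Finite R N]
    (p : Ideal R) [p.IsPrime] {x : R} (hx : x ∈ p) {u : N}
    (hu : ∀ n : ℕ, ∃ s ∉ p, ∃ v : N, x ^ n • v = s • u) : ∃ t ∉ p, t • u = 0 := by
  let f := LocalizedModule.mkLinearMap p.primeCompl N
  suffices f u = 0 by
    obtain ⟨t, ht⟩ := (IsLocalizedModule.eq_zero_iff p.primeCompl f).1 this
    exact ⟨t, t.2, ht⟩
  let A := Localization.AtPrime p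
  have : Module.Finite A (LocalizedModule p.primeCompl N) :=
    Module.Finite.of_isLocalizedModule p.primeCompl f
  have hA : IsNoetherianRing A := IsLocalization.isNoetherianRing p.primeCompl A inferInstance
  have hbot := Ideal.iInf_pow_smul_eq_bot_of_isLocalRing (R := A)
    (M := LocalizedModule p.primeCompl N) (maximalIdeal A) (Ideal.IsPrime.ne_top inferInstance)
  rw [← Submodule.mem_bot A, ← hbot, Submodule.mem_iInf]
  intro n
  obtain ⟨s, hs, v, hv⟩ := hu n
  have hsu : IsUnit (algebraMap R A s) := IsLocalization.map_units A (⟨s, hs⟩ : p.primeCompl)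
  have hxm : algebraMap R A x ∈ maximalIdeal A :=
    (IsLocalization.AtPrime.to_map_mem_maximal_iff A p x).2 hx
  rw [← Submodule.smul_mem_iff_of_isUnit
      (maximalIdeal A ^ n • (⊤ : Submodule A (LocalizedModule p.primeCompl N))) hsu, algebraMap_smul,
    ← map_smul, ← hv, map_smul, ← algebraMap_smul A (x ^ n),
    map_pow]
  exact Submodule.smul_mem_smul (Ideal.pow_mem_pow hxm n) Submodule.mem_top

/-- If all associated primes of `N` have dimension at least two, the intersection of the submodules
`powSaturation (maximalIdeal R) x N n` vanishes. -/
lemma eq_zero_of_mem_powSaturation [IsLocalRing R] {N : Type*} [AddCommGroup N] [Module R N]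
    [Module.Finite R N] (hN : ∀ q ∈ associatedPrimes R N, 2 ≤ ringKrullDim (R ⧸ q)) {x : R}
    (hx : x ∈ maximalIdeal R) {w : N} (hw : ∀ n, w ∈ powSaturation (maximalIdeal R) x N n) :
    w = 0 := by
  by_contra hw0
  have : Nontrivial ↥(Submodule.span R {w}) :=
    ⟨⟨w, Submodule.mem_span_singleton_self w⟩, 0, fun h => hw0 (congrArg Subtype.val h)⟩
  obtain ⟨q, hq⟩ := associatedPrimes.nonempty R ↥(Submodule.span R {w})
  have hqN : q ∈ associatedPrimes R N := IsAssociatedPrime.map_of_injective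
    (Submodule.span R {w}).subtype hq (Submodule.injective_subtype _)
  obtain ⟨hqp, ⟨u, huw⟩, hqu⟩ := isAssociatedPrime_iff.1 hq
  have hu (n : ℕ) : u ∈ powSaturation (maximalIdeal R) x N n :=
    (Submodule.span_singleton_le_iff_mem _ _).2 (hw n) huw
  obtain ⟨p, hp, hqp', hxp, hpm⟩ := exists_isPrime_mem_ne_maximalIdeal hx q (hN q hqN)
  obtain ⟨s, hsm, hsp⟩ : ∃ s ∈ maximalIdeal R, s ∉ p :=
    SetLike.not_le_iff_exists.1 fun h => hpm (le_antisymm (le_maximalIdeal hp.ne_top) h)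
  obtain ⟨t, htp, ht⟩ := exists_notMem_smul_eq_zero p hxp (u := u) fun n => by
    obtain ⟨k, hk⟩ := hu n
    exact ⟨s ^ k, fun h => hsp (hp.mem_of_pow_mem k h), hk _ (Ideal.pow_mem_pow hsm k)⟩
  refine htp (hqp' ?_)
  rw [hqu, Submodule.mem_colon_singleton, Submodule.mem_bot]
  exact Subtype.ext ht

end Separation

section Noetherian

variable {R : Type*} [CommRing R]

lemma AdicCompletion.exists_sub_algebraMap_mem {I : Ideal R} (hI : I.FG) (y : AdicCompletion I R) :
    ∃ r, y - algebraMap R _ r ∈ I.map (algebraMap R (AdicCompletion I R)) := by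
  obtain ⟨r, hr⟩ := Ideal.Quotient.mk_surjective (evalOneₐ I y)
  refine ⟨r, ?_⟩
  rw [← ker_evalOneₐ_eq_map I hI]
  change evalOneₐ I _ = 0
  rw [map_sub, ← hr, sub_eq_zero]
  simp

/-- The completion of a Noetherian ring is Noetherian. -/
lemma AdicCompletion.isNoetherianRing [IsNoetherianRing R] (I : Ideal R) :
    IsNoetherianRing (AdicCompletion I R) := by
  obtain ⟨n, s, hs⟩ := Submodule.fg_iff_exists_fin_generating_family.1 I.fg_of_isNoetherianRing
  let P := MvPolynomial (Fin n) R
  let J : Ideal P := MvPolynomial.idealOfVars (Fin n) R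
  let B := AdicCompletion I R
  let K : Ideal B := I.map (algebraMap R B)
  have hK : IsAdicComplete K B := isAdicComplete_self I I.fg_of_isNoetherianRing
  let φ : P →+* B := (MvPolynomial.aeval fun i => algebraMap R B (s i)).toRingHom
  have hφ : J.map φ = K := by
    have hI : K = Ideal.map (algebraMap R B) (Ideal.span (Set.range s)) :=
      congrArg (Ideal.map (algebraMap R B)) hs.symm
    rw [hI, Ideal.map_span, ← Set.range_comp, Ideal.map_span, ← Set.range_comp]
    exact congrArg (fun g => Ideal.span (Set.range g)) (funext fun i => MvPolynomial.aeval_X _ i)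
  have hJ : J.FG := J.fg_of_isNoetherianRing
  let A := AdicCompletion J P
  have hA : IsNoetherianRing A :=
    isNoetherianRing_of_ringEquiv _ (MvPowerSeries.toAdicCompletionAlgEquiv (Fin n) R).toRingEquiv
  have hc : IsAdicComplete (J.map (algebraMap P A)) A := isAdicComplete_self J hJ
  have hle (k : ℕ) : J ^ k ≤ (K ^ k).comap φ := by
    rw [← hφ, ← Ideal.map_pow]
    exact Ideal.le_comap_map
  let f (k : ℕ) : A →+* B ⧸ K ^ k :=
    (Ideal.quotientMap (K ^ k) φ (hle k)).comp (evalₐ J k).toRingHom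
  have hf {k l : ℕ} (hkl : k ≤ l) : (Ideal.Quotient.factorPow K hkl).comp (f l) = f k := by
    ext x
    obtain ⟨a, rfl⟩ := mk_surjective J P x
    change Ideal.Quotient.factorPow K hkl (Ideal.quotientMap _ φ (hle l) (evalₐ J l (mk J P a))) =
      Ideal.quotientMap _ φ (hle k) (evalₐ J k (mk J P a))
    have ha : Ideal.Quotient.mk (J ^ k) (a.val k) = Ideal.Quotient.mk (J ^ k) (a.val l) := by
      have := SModEq.sub_mem.1 (a.2 hkl)
      rw [smul_eq_mul, Ideal.mul_top] at this
      exact Ideal.Quotient.eq.2 this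
    rw [evalₐ_mk, evalₐ_mk, ha, Ideal.quotientMap_mk, Ideal.quotientMap_mk]
    rfl
  let F : A →+* B := IsAdicComplete.liftRingHom K f hf
  have hF (p : P) : F (algebraMap P A p) = φ p := by
    refine (IsHausdorff.eq_iff_smodEq (I := K)).2 fun k => ?_
    rw [SModEq.sub_mem, smul_eq_mul, Ideal.mul_top, ← Ideal.Quotient.eq,
      IsAdicComplete.mk_liftRingHom K f hf]
    change Ideal.quotientMap _ φ (hle k) (evalₐ J k (algebraMap P A p)) = _
    rw [← Ideal.quotientMap_mk (J := J ^ k)]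
    rfl
  have hFJ : (J.map (algebraMap P A)).map F = K := by
    rw [Ideal.map_map, ← hφ]
    congr 1
    exact RingHom.ext hF
  refine isNoetherianRing_of_surjective A B F (surjective_of_mk_map_comp_surjective
    (I := J.map (algebraMap P A)) (haus := by rw [hFJ]; infer_instance) F ?_)
  rw [hFJ]
  intro y
  obtain ⟨y, rfl⟩ := Ideal.Quotient.mk_surjective y
  obtain ⟨r, hr⟩ := exists_sub_algebraMap_mem I.fg_of_isNoetherianRing y
  refine ⟨algebraMap P A (MvPolynomial.C r), ?_⟩
  rw [RingHom.comp_apply, hF, eq_comm, Ideal.Quotient.eq]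
  have hφr : φ (MvPolynomial.C r) = algebraMap R B r := MvPolynomial.aeval_C _ _
  rw [hφr]
  exact hr

end Noetherian

section Completion

lemma Submodule.mem_of_forall_exists_sub_mem {R M : Type*} [CommRing R] [IsLocalRing R]
    [IsNoetherianRing R] [AddCommGroup M] [Module R M] [Module.Finite R M] (X : Submodule R M)
    {w : M} (h : ∀ l : ℕ, ∃ y ∈ maximalIdeal R ^ l • (⊤ : Submodule R M), w - y ∈ X) : w ∈ X := by
  rw [← Submodule.Quotient.mk_eq_zero, ← Submodule.mem_bot R,
    ← Ideal.iInf_pow_smul_eq_bot_of_isLocalRing (M := M ⧸ X) (maximalIdeal R)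
      (Ideal.IsPrime.ne_top inferInstance), Submodule.mem_iInf]
  intro l
  obtain ⟨y, hy, hwy⟩ := h l
  rw [(Submodule.Quotient.eq X).2 hwy]
  have := Submodule.mem_map_of_mem (f := X.mkQ) hy
  rw [Submodule.map_smul''] at this
  exact (smul_mono_right _ le_top : _ ≤ maximalIdeal R ^ l • (⊤ : Submodule R (M ⧸ X))) this

variable {R : Type*} [CommRing R] [IsLocalRing R] [IsNoetherianRing R]
  {M : Type*} [AddCommGroup M] [Module R M]

local notation "R̂" => AdicCompletion (maximalIdeal R) R
local notation "M̂" => AdicCompletion (maximalIdeal R) M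

lemma AdicCompletion.mem_maximalIdeal_pow_smul_top {l : ℕ} {y : M̂}
    (hy : eval (maximalIdeal R) M l y = 0) :
    y ∈ maximalIdeal R̂ ^ l • (⊤ : Submodule R̂ M̂) := by
  have hy' : y ∈ maximalIdeal R ^ l • (⊤ : Submodule R M̂) := by
    rw [pow_smul_top_eq_ker_eval (maximalIdeal R).fg_of_isNoetherianRing]
    exact hy
  refine Submodule.smul_induction_on hy' (fun r hr z _ => ?_) fun _ _ => add_mem
  rw [← algebraMap_smul R̂ r z, maximalIdeal_eq_map, ← Ideal.map_pow]
  exact Submodule.smul_mem_smul (Ideal.mem_map_of_mem _ hr) Submodule.mem_top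

lemma of_mem_powSaturation {x : R} {n : ℕ} {w : M} (hw : w ∈ powSaturation (maximalIdeal R) x M n) :
    AdicCompletion.of (maximalIdeal R) M w ∈
      powSaturation (maximalIdeal R̂) (algebraMap R R̂ x) M̂ n := by
  obtain ⟨k, hk⟩ := hw
  refine ⟨k, ?_⟩
  let J : Ideal R̂ := (LinearMap.range (LinearMap.lsmul R̂ M̂ (algebraMap R R̂ x ^ n))).comap
    (LinearMap.toSpanSingleton R̂ M̂ (AdicCompletion.of (maximalIdeal R) M w))
  change maximalIdeal R̂ ^ k ≤ J
  rw [AdicCompletion.maximalIdeal_eq_map, ← Ideal.map_pow, Ideal.map_le_iff_le_comap]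
  intro a ha
  obtain ⟨v, hv⟩ := hk a ha
  refine ⟨AdicCompletion.of (maximalIdeal R) M v, ?_⟩
  change algebraMap R R̂ x ^ n • AdicCompletion.of (maximalIdeal R) M v =
    algebraMap R R̂ a • AdicCompletion.of (maximalIdeal R) M w
  rw [← map_pow, algebraMap_smul, algebraMap_smul, ← map_smul, ← map_smul, hv]

variable [Module.Finite R M]

lemma exists_isSMulRegular_mem_maximalIdeal
    (hM : ∀ q ∈ associatedPrimes R̂ M̂, 2 ≤ ringKrullDim (R̂ ⧸ q)) :
    ∃ x ∈ maximalIdeal R, IsSMulRegular M x := by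
  have := AdicCompletion.isNoetherianRing (maximalIdeal R)
  by_contra! h
  have hsub : (maximalIdeal R : Set R) ⊆ ⋃ p ∈ associatedPrimes R M, (p : Set R) := by
    rw [biUnion_associatedPrimes_eq_compl_regular]
    exact h
  obtain ⟨p, hp, hmp⟩ := (Ideal.subset_union_prime_finite (associatedPrimes.finite R M)
    (f := id) 0 0 fun _ h _ _ => h.isPrime).1 hsub
  obtain ⟨hpp, w, rfl⟩ := isAssociatedPrime_iff.1 hp
  have hw0 : AdicCompletion.of (maximalIdeal R) M w ≠ 0 := fun h0 => hpp.ne_top <| by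
    have := IsHausdorff.of_le_jacobson (maximalIdeal R) M (maximalIdeal_le_jacobson _)
    rw [(AdicCompletion.of_injective (maximalIdeal R) M) (h0.trans (map_zero _).symm)]
    simp
  obtain ⟨P, hP, hle⟩ := exists_le_isAssociatedPrime_of_isNoetherianRing R̂ _ hw0
  have hPm : P = maximalIdeal R̂ := by
    refine le_antisymm (le_maximalIdeal hP.isPrime.ne_top) (le_trans ?_ hle)
    rw [AdicCompletion.maximalIdeal_eq_map, Ideal.map_le_iff_le_comap]
    intro a ha
    have := hmp ha
    rw [id, Submodule.mem_colon_singleton, Submodule.mem_bot] at this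
    rw [Ideal.mem_comap, Submodule.mem_colon_singleton, Submodule.mem_bot, algebraMap_smul,
      ← map_smul, this, map_zero]
  have h2 := hM P hP
  rw [hPm, ringKrullDim_eq_zero_of_isField
    ((Ideal.Quotient.maximal_ideal_iff_isField_quotient _).1 inferInstance)] at h2
  exact absurd h2 (by decide)

/-- Under the dimension hypothesis on the associated primes of the completion, `powSaturation` is
eventually contained in `xM`. -/
lemma exists_powSaturation_le
    (hM : ∀ q ∈ associatedPrimes R̂ M̂, 2 ≤ ringKrullDim (R̂ ⧸ q)) {x : R}
    (hxm : x ∈ maximalIdeal R) (hx : IsSMulRegular M x) :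
    ∃ c, ∀ w ∈ powSaturation (maximalIdeal R) x M c, ∃ v, w = x • v := by
  have := AdicCompletion.isNoetherianRing (maximalIdeal R)
  have : Module.Finite R̂ M̂ := Module.Finite.of_surjective
    (AdicCompletion.ofTensorProduct (maximalIdeal R) M)
    (AdicCompletion.ofTensorProduct_surjective_of_finite _ _)
  obtain ⟨c, hc⟩ := exists_powSaturation_le_sup_pow hx
  choose! g hg v hv using hc
  refine ⟨c, fun w hw => ?_⟩
  let s (i : ℕ) : M := Nat.rec w g i
  have hs (i : ℕ) : s i ∈ powSaturation (maximalIdeal R) x M (c + i) := by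
    induction i with
    | zero => exact hw
    | succ i ih => exact hg i _ ih
  have hsub (i j : ℕ) (hij : i ≤ j) :
      s i - s j ∈ LinearMap.range (LinearMap.lsmul R M (x ^ (i + 1))) := by
    induction j, hij using Nat.le_induction with
    | base => simp
    | succ j hij ih =>
      rw [← sub_add_sub_cancel (s i) (s j)]
      refine add_mem ih ⟨x ^ (j - i) • v j (s j), ?_⟩
      have := hv j _ (hs j)
      change x ^ (i + 1) • x ^ (j - i) • v j (s j) = s j - g j (s j)
      rw [smul_smul, ← pow_add, show i + 1 + (j - i) = j + 1 by omega, eq_sub_iff_add_eq', ← this]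
  let S := AdicCompletion.AdicCauchySequence.mk (maximalIdeal R) M s fun n => by
    obtain ⟨u, hu⟩ := hsub n (n + 1) n.le_succ
    rw [SModEq.sub_mem, ← hu]
    exact Submodule.smul_mem_smul (Ideal.pow_le_pow_right n.le_succ (Ideal.pow_mem_pow hxm _))
      Submodule.mem_top
  let z : M̂ := AdicCompletion.mk _ _ S
  have hz (l : ℕ) : AdicCompletion.eval (maximalIdeal R) M l z =
      (maximalIdeal R ^ l • (⊤ : Submodule R M)).mkQ (s l) := rfl
  have hz0 : z = 0 := by
    refine eq_zero_of_mem_powSaturation hM (x := algebraMap R R̂ x) ?_ fun n => ?_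
    · rw [AdicCompletion.maximalIdeal_eq_map]
      exact Ideal.mem_map_of_mem _ hxm
    · let X := LinearMap.range (LinearMap.lsmul R̂ M̂ (algebraMap R R̂ x ^ n))
      have hX : z - AdicCompletion.of (maximalIdeal R) M (s n) ∈ X := by
        refine Submodule.mem_of_forall_exists_sub_mem X fun l =>
          ⟨z - AdicCompletion.of _ M (s (max l n)), ?_, ?_⟩
        · refine Submodule.smul_mono_left (Ideal.pow_le_pow_right (le_max_left l n))
            (AdicCompletion.mem_maximalIdeal_pow_smul_top ?_)
          rw [map_sub, hz, AdicCompletion.eval_of, sub_self]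
        · obtain ⟨u, hu⟩ := hsub n (max l n) (le_max_right l n)
          refine ⟨AdicCompletion.of _ M (-(x • u)), ?_⟩
          rw [sub_sub_sub_cancel_left, ← map_sub, ← neg_sub, ← hu]
          change algebraMap R R̂ x ^ n • _ = AdicCompletion.of _ _ (-(x ^ (n + 1) • u))
          rw [← map_pow, algebraMap_smul, ← map_smul, smul_neg, smul_smul, pow_succ]
      obtain ⟨u, hu⟩ := hX
      rw [← sub_add_cancel z (AdicCompletion.of _ M (s n)), ← hu]
      exact add_mem (pow_smul_mem_powSaturation n u)
        (of_mem_powSaturation (powSaturation_antitone (by omega) (hs n)))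
  have hwx : w ∈ LinearMap.range (LinearMap.lsmul R M x) := by
    refine Submodule.mem_of_forall_exists_sub_mem _ fun l =>
      ⟨s l, (Submodule.Quotient.mk_eq_zero _).1 ?_, by simpa [s] using hsub 0 l l.zero_le⟩
    have := hz l
    rw [hz0, map_zero] at this
    exact this.symm
  obtain ⟨u, hu⟩ := hwx
  exact ⟨u, hu.symm⟩

end Completion

theorem statement4 (R : Type) [CommRing R] [IsLocalRing R] [IsNoetherianRing R]
    (M : Type) [AddCommGroup M] [Module R M] [Module.Finite R M]
    (hdim : mDim R M = ringKrullDim R) (hdim2 : ((2 : ℕ) : WithBot ℕ∞) ≤ mDim R M)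
    (hu : IsUnmixed R M) :
    Module.Finite R ↥(LC R 1 M) := by
  have h2 : ∀ q ∈ associatedPrimes (AdicCompletion (maximalIdeal R) R)
      (AdicCompletion (maximalIdeal R) M),
      2 ≤ ringKrullDim (AdicCompletion (maximalIdeal R) R ⧸ q) :=
    fun q hq => hdim2.trans_eq (hu q hq).symm
  obtain ⟨x, hxm, hx⟩ := exists_isSMulRegular_mem_maximalIdeal h2
  obtain ⟨c, hc⟩ := exists_powSaturation_le h2 hxm hx
  obtain ⟨N, hN⟩ := exists_extension_of_powSaturation_le hxm hx hc
  exact finite_localCohomology_one (maximalIdeal R) (ModuleCat.of R M) N hN
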